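/- For all integers m ≥ 1, n ≥ 1 and 0 ≤ d ≤ ⌊(n−1)/2⌋, the number of admissible pinnacle sets of cardinality at most d in Z_m ≀ S_n is given by the positive sum: #APS_d(m,n) = Σ_{k=0}^{d} (m−1)^k · C(n,k) · C(n−k−1, d−k). -/

import Mathlib

open Finset

/-- `Prec p q` means the colored symbol `p = ξ^{p.1}(p.2)` precedes (is smaller than)
`q = ξ^{q.1}(q.2)`: `a > b`, or (`a = b` and `x > y`). -/
def Prec (p q : ℕ × ℕ) : Prop :=
  q.1 < p.1 ∨ (p.1 = q.1 ∧ q.2 < p.2)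

instance : DecidableRel Prec := fun p q => by
  unfold Prec; infer_instance

/-- `w : ℕ → ℕ × ℕ` (read on positions `1,…,n`) is an element of `Z_m ≀ S_n`:
each entry has color `< m` and norm in `{1,…,n}`, and the norms are pairwise distinct. -/
def IsGenPerm (m n : ℕ) (w : ℕ → ℕ × ℕ) : Prop :=
  (∀ i ∈ Finset.Icc 1 n, (w i).1 < m ∧ (w i).2 ∈ Finset.Icc 1 n) ∧
    Set.InjOn (fun i => (w i).2) (Set.Icc 1 n)

/-- The pinnacle set of the word `w`: values at interior positions `2 ≤ i ≤ n-1`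
that strictly dominate both neighbors. -/
def pin (n : ℕ) (w : ℕ → ℕ × ℕ) : Finset (ℕ × ℕ) :=
  ((Finset.Icc 2 (n - 1)).filter
      (fun i => Prec (w (i - 1)) (w i) ∧ Prec (w (i + 1)) (w i))).image w

/-- `P` is an admissible pinnacle set for `Z_m ≀ S_n`. -/
def IsAdmissible (m n : ℕ) (P : Finset (ℕ × ℕ)) : Prop :=
  ∃ w, IsGenPerm m n w ∧ pin n w = P

/-- `APS m n d` : admissible pinnacle sets for `Z_m ≀ S_n` of cardinality at most `d`. -/
def APS (m n d : ℕ) : Set (Finset (ℕ × ℕ)) :=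
  {P | IsAdmissible m n P ∧ P.card ≤ d}

/-- Scanning `S` downwards, the members of `B` stay strictly outnumbered by the other members. -/
def IsBallot (S B : Finset ℕ) : Prop :=
  ∀ x ∈ B, #{y ∈ B | x ≤ y} < #{y ∈ S \ B | x < y}

open Classical in
/-- The ballot subsets of `S` with at most `e` elements. -/
noncomputable def ballotSets (S : Finset ℕ) (e : ℕ) : Finset (Finset ℕ) :=
  {B ∈ S.powerset | #B ≤ e ∧ IsBallot S B}

lemma mem_ballotSets {S B : Finset ℕ} {e : ℕ} :
    B ∈ ballotSets S e ↔ B ⊆ S ∧ #B ≤ e ∧ IsBallot S B := by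
  simp [ballotSets]

lemma IsBallot.two_mul_card_lt {S B : Finset ℕ} (h : IsBallot S B) (hBS : B ⊆ S)
    (hS : S.Nonempty) : 2 * #B < #S := by
  rcases B.eq_empty_or_nonempty with rfl | hB
  · simpa using hS
  · have hmin := h _ (B.min'_mem hB)
    rw [filter_true_of_mem (fun y hy => B.min'_le y hy)] at hmin
    have := card_filter_le (S \ B) (fun y => B.min' hB < y)
    have := card_sdiff_add_card_eq_card hBS
    omega

lemma isBallot_insert_left {S B : Finset ℕ} {a : ℕ} (ha : ∀ x ∈ S, a < x) (hBS : B ⊆ S) :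
    IsBallot (insert a S) B ↔ IsBallot S B := by
  refine forall₂_congr fun x hx => ?_
  have : {y ∈ insert a S \ B | x < y} = {y ∈ S \ B | x < y} := by
    ext y
    have := ha x (hBS hx)
    simp only [mem_filter, mem_sdiff, mem_insert]
    grind
  rw [this]

lemma isBallot_insert_insert {S B : Finset ℕ} {a : ℕ} (ha : ∀ x ∈ S, a < x) (hBS : B ⊆ S) :
    IsBallot (insert a S) (insert a B) ↔ IsBallot S B ∧ 2 * #B + 1 < #S := by
  have haS : a ∉ S := fun h => (ha a h).false
  have haB : a ∉ B := fun h => haS (hBS h)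
  have hsd : insert a S \ insert a B = S \ B := by grind
  have hcard := card_sdiff_add_card_eq_card hBS
  have hlow : #{y ∈ insert a B | a ≤ y} < #{y ∈ S \ B | a < y} ↔ 2 * #B + 1 < #S := by
    rw [filter_true_of_mem (by grind), filter_true_of_mem (by grind), card_insert_of_notMem haB]
    omega
  have hrest : ∀ x ∈ B, {y ∈ insert a B | x ≤ y} = {y ∈ B | x ≤ y} := by
    intro x hx
    have := ha x (hBS hx)
    rw [filter_insert, if_neg (by omega)]
  unfold IsBallot
  rw [forall_mem_insert, hsd, hlow, and_comm]
  exact and_congr_left fun _ => forall₂_congr fun x hx => by rw [hrest x hx]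

lemma ballotSets_zero (S : Finset ℕ) : ballotSets S 0 = {∅} := by
  ext B
  simp only [mem_ballotSets, nonpos_iff_eq_zero, card_eq_zero, mem_singleton]
  constructor
  · exact fun h => h.2.1
  · rintro rfl
    simp [IsBallot]

lemma ballotSets_succ_of_le {S : Finset ℕ} {e : ℕ} (hS : S.Nonempty) (he : #S ≤ 2 * (e + 1)) :
    ballotSets S (e + 1) = ballotSets S e := by
  ext B
  simp only [mem_ballotSets]
  constructor
  · rintro ⟨h1, -, h3⟩
    have := h3.two_mul_card_lt h1 hS
    exact ⟨h1, by omega, h3⟩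
  · rintro ⟨h1, h2, h3⟩
    exact ⟨h1, by omega, h3⟩

lemma card_ballotSets_insert {S : Finset ℕ} {a e : ℕ} (ha : ∀ x ∈ S, a < x)
    (he : 2 * (e + 1) ≤ #S) :
    #(ballotSets (insert a S) (e + 1)) = #(ballotSets S (e + 1)) + #(ballotSets S e) := by
  have haS : a ∉ S := fun h => (ha a h).false
  have hunion : ballotSets (insert a S) (e + 1) =
      ballotSets S (e + 1) ∪ (ballotSets S e).image (insert a) := by
    ext B
    simp only [mem_union, mem_image, mem_ballotSets]
    constructor
    · rintro ⟨h1, h2, h3⟩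
      by_cases haB : a ∈ B
      · right
        have hsub : B.erase a ⊆ S := by grind
        have hins : insert a (B.erase a) = B := insert_erase haB
        rw [← hins, isBallot_insert_insert ha hsub] at h3
        exact ⟨B.erase a, ⟨hsub, by rw [card_erase_of_mem haB]; omega, h3.1⟩, hins⟩
      · have hsub : B ⊆ S := by grind
        exact .inl ⟨hsub, h2, (isBallot_insert_left ha hsub).1 h3⟩
    · rintro (⟨h1, h2, h3⟩ | ⟨B, ⟨h1, h2, h3⟩, rfl⟩)
      · exact ⟨h1.trans (subset_insert _ _), h2, (isBallot_insert_left ha h1).2 h3⟩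
      · refine ⟨insert_subset_insert _ h1, ?_, (isBallot_insert_insert ha h1).2 ⟨h3, by omega⟩⟩
        exact (card_insert_le _ _).trans (by omega)
  rw [hunion, card_union_of_disjoint, card_image_of_injOn]
  · intro B hB C hC h
    have hB' := (mem_ballotSets.1 hB).1
    have hC' := (mem_ballotSets.1 hC).1
    have h' : insert a B = insert a C := h
    rw [← erase_insert (fun h => haS (hB' h)), h', erase_insert (fun h => haS (hC' h))]
  · rw [disjoint_left]
    intro B hB hB'
    obtain ⟨C, -, rfl⟩ := mem_image.1 hB'
    exact haS ((mem_ballotSets.1 hB).1 (mem_insert_self _ _))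

theorem card_ballotSets {S : Finset ℕ} (hS : S.Nonempty) {e : ℕ} (he : 2 * e ≤ #S) :
    #(ballotSets S e) = (#S - 1).choose e := by
  induction S using Finset.induction_on_min generalizing e with
  | empty => simp at hS
  | insert a S ha ih =>
    have haS : a ∉ S := fun h => (ha a h).false
    rw [card_insert_of_notMem haS] at he ⊢
    have small : ∀ e, 2 * e ≤ #S → #(ballotSets (insert a S) e) = (#S).choose e := by
      rintro (_ | e) he
      · simp [ballotSets_zero]
      · have hS : S.Nonempty := card_pos.1 (by omega)
        rw [card_ballotSets_insert ha he, ih hS he, ih hS (by omega)]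
        obtain ⟨k, hk⟩ : ∃ k, #S = k + 1 := ⟨#S - 1, by omega⟩
        simp [hk, Nat.choose_succ_succ, add_comm]
    rcases Nat.lt_or_ge (#S) (2 * e) with h | h
    · obtain ⟨e, rfl⟩ : ∃ f, e = f + 1 := ⟨e - 1, by omega⟩
      rw [ballotSets_succ_of_le hS (by rw [card_insert_of_notMem haS]; omega), small e (by omega),
        Nat.add_sub_cancel]
      exact Nat.choose_symm_of_eq_add (by omega)
    · simpa using small e h

lemma Prec.trans {p q r : ℕ × ℕ} (h₁ : Prec p q) (h₂ : Prec q r) : Prec p r := by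
  unfold Prec at *
  omega

lemma Prec.asymm {p q : ℕ × ℕ} (h : Prec p q) : ¬ Prec q p := by
  unfold Prec at *
  omega

lemma not_prec_self (p : ℕ × ℕ) : ¬ Prec p p := fun h => h.asymm h

/-- Every finite set of symbols can be listed increasingly. -/
lemma exists_prec_enumeration (s : Finset (ℕ × ℕ)) :
    ∃ f : ℕ → ℕ × ℕ, (∀ i j, i < j → j < #s → Prec (f i) (f j)) ∧ (range #s).image f = s := by
  induction h : #s generalizing s with
  | zero => exact ⟨fun _ => (0, 0), by simp, by simp [card_eq_zero.1 h]⟩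
  | succ k ih =>
    obtain ⟨p, hp, hmax⟩ := s.exists_min_image toLex (card_pos.1 (by omega))
    obtain ⟨f, hf, hfs⟩ := ih (s.erase p) (by rw [card_erase_of_mem hp]; omega)
    refine ⟨Function.update f k p, fun i j hij hj => ?_, ?_⟩
    · rw [Function.update_of_ne (by omega)]
      rcases Nat.lt_succ_iff_lt_or_eq.1 hj with hj | rfl
      · rw [Function.update_of_ne (by omega)]
        exact hf i j hij hj
      · rw [Function.update_self]
        have hi : f i ∈ s.erase p := by
          rw [← hfs]
          exact mem_image_of_mem _ (mem_range.2 hij)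
        obtain ⟨hne, hi⟩ := mem_erase.1 hi
        have hle := (hmax _ hi).lt_of_ne (fun h => hne (toLex.injective h).symm)
        rw [Prod.Lex.toLex_lt_toLex] at hle
        exact hle.imp id fun h => ⟨h.1.symm, h.2⟩
    · rw [range_add_one, image_insert, Function.update_self]
      have : (range k).image (Function.update f k p) = (range k).image f :=
        image_congr fun i hi => Function.update_of_ne (by simp at hi; omega) _ _
      rw [this, hfs, insert_erase hp]

lemma mem_pin {n : ℕ} {w : ℕ → ℕ × ℕ} {p : ℕ × ℕ} :
    p ∈ pin n w ↔ ∃ i, (2 ≤ i ∧ i ≤ n - 1) ∧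
      (Prec (w (i - 1)) (w i) ∧ Prec (w (i + 1)) (w i)) ∧ w i = p := by
  simp [pin, and_assoc]

lemma IsGenPerm.injOn {m n : ℕ} {w : ℕ → ℕ × ℕ} (hw : IsGenPerm m n w) :
    Set.InjOn w (Set.Icc 1 n) :=
  fun _ hi _ hj h => hw.2 hi hj (congrArg Prod.snd h)

/-- Below any pinnacle, the pinnacles are strictly outnumbered by the other entries. -/
lemma IsGenPerm.card_pin_lt {m n : ℕ} {w : ℕ → ℕ × ℕ} (hw : IsGenPerm m n w) {p : ℕ × ℕ}
    (hp : p ∈ pin n w) :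
    #{q ∈ pin n w | q = p ∨ Prec q p} <
      #{v ∈ (Icc 1 n).image w \ pin n w | Prec v p} := by
  classical
  set I : Finset ℕ := {i ∈ Icc 2 (n - 1) | (Prec (w (i - 1)) (w i) ∧ Prec (w (i + 1)) (w i)) ∧
    (w i = p ∨ Prec (w i) p)} with hI
  have memI : ∀ i, i ∈ I ↔ (2 ≤ i ∧ i ≤ n - 1) ∧
      (Prec (w (i - 1)) (w i) ∧ Prec (w (i + 1)) (w i)) ∧ (w i = p ∨ Prec (w i) p) := by
    simp [hI]
  have hlower : #{q ∈ pin n w | q = p ∨ Prec q p} ≤ #I := by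
    refine (card_le_card ?_).trans (card_image_le (f := w))
    intro q hq
    obtain ⟨hq, hqp⟩ := mem_filter.1 hq
    obtain ⟨i, hi, hi', rfl⟩ := mem_pin.1 hq
    exact mem_image_of_mem _ ((memI i).2 ⟨hi, hi', hqp⟩)
  have hIne : I.Nonempty := by
    obtain ⟨i, hi, hi', hip⟩ := mem_pin.1 hp
    exact ⟨i, (memI i).2 ⟨hi, hi', .inl hip⟩⟩
  have below : ∀ i j, i ∈ I → 1 ≤ j → j ≤ n → Prec (w j) (w i) → (j + 1 = i ∨ j = i + 1) →
      w j ∈ ({v ∈ (Icc 1 n).image w \ pin n w | Prec v p} : Finset _) := by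
    intro i j hi hj hjn hji hadj
    obtain ⟨hi1, hi2, hi3⟩ := (memI i).1 hi
    simp only [mem_filter, mem_sdiff]
    refine ⟨⟨mem_image_of_mem _ (mem_Icc.2 ⟨hj, hjn⟩), fun hpin => ?_⟩, ?_⟩
    · obtain ⟨k, hk, hk', hkj⟩ := mem_pin.1 hpin
      obtain rfl : k = j := hw.injOn ⟨by omega, by omega⟩ ⟨hj, hjn⟩ hkj
      rcases hadj with rfl | rfl
      · exact hji.asymm hk'.2
      · exact hji.asymm hk'.1
    · rcases hi3 with rfl | hi3
      · exact hji
      · exact hji.trans hi3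
  set J : Finset ℕ := insert (I.min' hIne - 1) (I.image (· + 1)) with hJ
  have hmin := I.min'_mem hIne
  have hmin2 := ((memI _).1 hmin).1
  have hJcard : #J = #I + 1 := by
    rw [hJ, card_insert_of_notMem, card_image_of_injective _ (add_left_injective 1)]
    intro h
    obtain ⟨i, hi, h⟩ := mem_image.1 h
    have := I.min'_le i hi
    omega
  have hJIcc : (J : Set ℕ) ⊆ Set.Icc 1 n := by
    intro j hj
    rcases mem_insert.1 hj with rfl | hj
    · exact ⟨by omega, by omega⟩
    · obtain ⟨i, hi, rfl⟩ := mem_image.1 hj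
      have := ((memI i).1 hi).1
      exact ⟨by omega, by omega⟩
  have hupper : #J ≤ #{v ∈ (Icc 1 n).image w \ pin n w | Prec v p} := by
    rw [← card_image_of_injOn (hw.injOn.mono hJIcc)]
    refine card_le_card (image_subset_iff.2 fun j hj => ?_)
    have hj' := hJIcc hj
    rcases mem_insert.1 hj with rfl | hj
    · exact below _ _ hmin hj'.1 hj'.2 ((memI _).1 hmin).2.1.1 (by omega)
    · obtain ⟨i, hi, rfl⟩ := mem_image.1 hj
      exact below i _ hi hj'.1 hj'.2 ((memI i).1 hi).2.1.2 (by omega)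
  omega

/-- A sufficient criterion for admissibility: list `P` and the remaining symbols (taken with the
smallest color) increasingly, and interleave them. -/
lemma isAdmissible_of_card_lt {m n : ℕ} (hm : 1 ≤ m) {P V : Finset (ℕ × ℕ)}
    (hP : P ⊆ range m ×ˢ Icc 1 n) (hinj : Set.InjOn Prod.snd (P : Set (ℕ × ℕ)))
    (hV : V = (Icc 1 n \ P.image Prod.snd).image (fun x => (m - 1, x)))
    (hcard : 2 * #P < n)
    (h : ∀ p ∈ P, #{q ∈ P | q = p ∨ Prec q p} < #{v ∈ V | Prec v p}) :
    IsAdmissible m n P := by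
  classical
  obtain ⟨f, hf, hfP⟩ := exists_prec_enumeration P
  obtain ⟨g, hg, hgV⟩ := exists_prec_enumeration V
  have hPsnd : P.image Prod.snd ⊆ Icc 1 n := by
    intro x hx
    obtain ⟨p, hp, rfl⟩ := mem_image.1 hx
    exact (mem_product.1 (hP hp)).2
  have hVcard : #V + #P = n := by
    rw [hV, card_image_of_injective _ (Prod.mk_right_injective _), ← card_image_of_injOn hinj,
      card_sdiff_add_card_eq_card hPsnd, Nat.card_Icc, Nat.add_sub_cancel]
  have hfmem : ∀ j < #P, f j ∈ P := fun j hj => by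
    simpa only [hfP] using mem_image_of_mem f (mem_range.2 hj)
  have hgmem : ∀ j < #V, g j ∈ V := fun j hj => by
    simpa only [hgV] using mem_image_of_mem g (mem_range.2 hj)
  have hfinj : ∀ i j, i < #P → j < #P → f i = f j → i = j := by
    intro i j hi hj hij
    rcases lt_trichotomy i j with h | h | h
    · exact absurd (hij ▸ hf i j h hj) (not_prec_self _)
    · exact h
    · exact absurd (hij ▸ hf j i h hi) (not_prec_self _)
  have hginj : ∀ i j, i < #V → j < #V → g i = g j → i = j := by
    intro i j hi hj hij
    rcases lt_trichotomy i j with h | h | h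
    · exact absurd (hij ▸ hg i j h hj) (not_prec_self _)
    · exact h
    · exact absurd (hij ▸ hg j i h hi) (not_prec_self _)
  have hnext : ∀ j < #P, Prec (g (j + 1)) (f j) := by
    intro j hj
    by_contra hnot
    have hle : #{v ∈ V | Prec v (f j)} ≤ #((range (j + 1)).image g) := by
      refine card_le_card fun v hv => ?_
      obtain ⟨hv, hvj⟩ := mem_filter.1 hv
      rw [← hgV] at hv
      obtain ⟨i, hi, rfl⟩ := mem_image.1 hv
      rw [mem_range] at hi
      refine mem_image_of_mem _ (mem_range.2 ?_)
      by_contra hij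
      rcases (Nat.le_of_not_lt hij).eq_or_lt with rfl | hij
      · exact hnot hvj
      · exact hnot ((hg _ _ hij hi).trans hvj)
    have hge : #((range (j + 1)).image f) ≤ #{q ∈ P | q = f j ∨ Prec q (f j)} := by
      refine card_le_card (image_subset_iff.2 fun i hi => ?_)
      rw [mem_range] at hi
      refine mem_filter.2 ⟨hfmem i (by omega), ?_⟩
      rcases (Nat.lt_succ_iff.1 hi).eq_or_lt with rfl | hi
      · exact .inl rfl
      · exact .inr (hf i j hi hj)
    rw [card_image_of_injOn, card_range] at hge
    · have h1 := h _ (hfmem j hj)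
      have h2 : #((range (j + 1)).image g) ≤ j + 1 := by
        simpa using card_image_le (s := range (j + 1)) (f := g)
      omega
    · intro a ha b hb hab
      simp only [coe_range, Set.mem_Iio] at ha hb
      exact hfinj a b (by omega) (by omega) hab
  have hprev : ∀ j < #P, Prec (g j) (f j) := fun j hj =>
    (hg j (j + 1) (by omega) (by omega)).trans (hnext j hj)
  set w : ℕ → ℕ × ℕ := fun i =>
    if i ≤ 2 * #P then (if i % 2 = 0 then f (i / 2 - 1) else g (i / 2))
    else g (i - 1 - #P) with hwdef
  have cases_pos : ∀ i, 1 ≤ i → i ≤ n →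
      (∃ j < #P, i = 2 * (j + 1) ∧ w i = f j) ∨
      (∃ j < #P, i = 2 * j + 1 ∧ w i = g j) ∨
      (∃ j, #P ≤ j ∧ j < #V ∧ i = j + 1 + #P ∧ w i = g j) := by
    intro i h1 hn
    by_cases hi : i ≤ 2 * #P
    · rcases Nat.mod_two_eq_zero_or_one i with h2 | h2
      · exact .inl ⟨i / 2 - 1, by omega, by omega, by simp [hwdef, hi, h2]⟩
      · exact .inr (.inl ⟨i / 2, by omega, by omega, by simp [hwdef, hi, h2]⟩)
    · exact .inr (.inr ⟨i - 1 - #P, by omega, by omega, by omega, by simp [hwdef, hi]⟩)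
  have wf : ∀ j < #P, w (2 * (j + 1)) = f j := fun j hj => by
    simp only [hwdef]
    rw [if_pos (by omega), if_pos (by omega)]
    congr 1
    omega
  have wg : ∀ j ≤ #P, w (2 * j + 1) = g j := fun j hj => by
    simp only [hwdef]
    split_ifs
    · omega
    · congr 1
      omega
    · congr 1
      omega
  have wg' : ∀ j, #P ≤ j → w (j + 1 + #P) = g j := fun j hj => by
    simp only [hwdef]
    rw [if_neg (by omega)]
    congr 1
    omega
  have hVmem : ∀ v ∈ V, v.1 = m - 1 ∧ v.2 ∈ Icc 1 n ∧ v.2 ∉ P.image Prod.snd := by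
    intro v hv
    rw [hV] at hv
    obtain ⟨x, hx, rfl⟩ := mem_image.1 hv
    exact ⟨rfl, mem_sdiff.1 hx⟩
  have hVinj : ∀ u ∈ V, ∀ v ∈ V, u.2 = v.2 → u = v := fun u hu v hv huv =>
    Prod.ext ((hVmem u hu).1.trans (hVmem v hv).1.symm) huv
  have hfg : ∀ i j, i < #P → j < #V → (f i).2 ≠ (g j).2 := fun i j hi hj hij =>
    (hVmem _ (hgmem j hj)).2.2 (hij ▸ mem_image_of_mem _ (hfmem i hi))
  have gg : ∀ i j, i < #V → j < #V → (g i).2 = (g j).2 → i = j := fun i j hi hj hij =>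
    hginj i j hi hj (hVinj _ (hgmem i hi) _ (hgmem j hj) hij)
  refine ⟨w, ⟨fun i hi => ?_, fun i hi j hj hij => ?_⟩, ?_⟩
  · rw [mem_Icc] at hi
    have hPmem : ∀ j < #P, (f j).1 < m ∧ (f j).2 ∈ Icc 1 n := fun j hj => by
      simpa using hP (hfmem j hj)
    have hgmem' : ∀ j < #V, (g j).1 < m ∧ (g j).2 ∈ Icc 1 n := fun j hj => by
      have := hVmem _ (hgmem j hj)
      exact ⟨by omega, this.2.1⟩
    rcases cases_pos i hi.1 hi.2 with ⟨j, hj, -, h⟩ | ⟨j, hj, -, h⟩ | ⟨j, -, hj, -, h⟩ <;> rw [h]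
    · exact hPmem j hj
    · exact hgmem' j (by omega)
    · exact hgmem' j hj
  · simp only at hij
    rcases cases_pos i hi.1 hi.2 with ⟨a, ha, hia, h⟩ | ⟨a, ha, hia, h⟩ | ⟨a, ha', ha, hia, h⟩ <;>
    rcases cases_pos j hj.1 hj.2 with ⟨b, hb, hjb, h'⟩ | ⟨b, hb, hjb, h'⟩ | ⟨b, hb', hb, hjb, h'⟩ <;>
    rw [h, h'] at hij
    · have := hfinj a b ha hb (hinj (hfmem a ha) (hfmem b hb) hij)
      omega
    · exact absurd hij (hfg a b ha (by omega))
    · exact absurd hij (hfg a b ha hb)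
    · exact absurd hij.symm (hfg b a hb (by omega))
    · have := gg a b (by omega) (by omega) hij
      omega
    · have := gg a b (by omega) (by omega) hij
      omega
    · exact absurd hij.symm (hfg b a hb (by omega))
    · have := gg a b (by omega) (by omega) hij
      omega
    · have := gg a b (by omega) (by omega) hij
      omega
  · ext p
    rw [mem_pin]
    constructor
    · rintro ⟨i, hi, ⟨hl, hr⟩, rfl⟩
      rcases cases_pos i (by omega) (by omega) with
        ⟨j, hj, hij, h⟩ | ⟨j, hj, hij, h⟩ | ⟨j, hj', hj, hij, h⟩
      · exact h ▸ hfmem j hj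
      · rw [h, hij, show 2 * j + 1 + 1 = 2 * (j + 1) by ring, wf j hj] at hr
        exact absurd (hprev j hj) hr.asymm
      · rw [h, hij, show j + 1 + #P + 1 = (j + 1) + 1 + #P by ring, wg' _ (by omega)] at hr
        exact absurd (hg j (j + 1) (by omega) (by omega)) hr.asymm
    · intro hp
      rw [← hfP] at hp
      obtain ⟨j, hj, rfl⟩ := mem_image.1 hp
      rw [mem_range] at hj
      refine ⟨2 * (j + 1), ⟨by omega, by omega⟩, ⟨?_, ?_⟩, wf j hj⟩
      · rw [wf j hj, show 2 * (j + 1) - 1 = 2 * j + 1 by omega, wg j hj.le]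
        exact hprev j hj
      · rw [wf j hj, wg (j + 1) hj]
        exact hnext j hj

lemma IsAdmissible.subset {m n : ℕ} {P : Finset (ℕ × ℕ)} (h : IsAdmissible m n P) :
    P ⊆ range m ×ˢ Icc 1 n := by
  obtain ⟨w, hw, rfl⟩ := h
  intro p hp
  obtain ⟨i, hi, -, rfl⟩ := mem_pin.1 hp
  have := hw.1 i (mem_Icc.2 ⟨by omega, by omega⟩)
  exact mem_product.2 ⟨mem_range.2 this.1, this.2⟩

lemma IsAdmissible.injOn_snd {m n : ℕ} {P : Finset (ℕ × ℕ)} (h : IsAdmissible m n P) :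
    Set.InjOn Prod.snd (P : Set (ℕ × ℕ)) := by
  obtain ⟨w, hw, rfl⟩ := h
  intro p hp q hq hpq
  obtain ⟨i, hi, -, rfl⟩ := mem_pin.1 hp
  obtain ⟨j, hj, -, rfl⟩ := mem_pin.1 hq
  exact congrArg w (hw.2 ⟨by omega, by omega⟩ ⟨by omega, by omega⟩ hpq)

lemma IsAdmissible.isBallot {m n : ℕ} {P : Finset (ℕ × ℕ)} {A B : Finset ℕ}
    (h : IsAdmissible m n P) (hA : ∀ x, x ∈ A ↔ ∃ c < m - 1, (c, x) ∈ P)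
    (hB : ∀ x, x ∈ B ↔ (m - 1, x) ∈ P) : IsBallot (Icc 1 n \ A) B := by
  obtain ⟨w, hw, rfl⟩ := h
  intro x hx
  have key := hw.card_pin_lt ((hB x).1 hx)
  have hleft : #{y ∈ B | x ≤ y} ≤
      #{q ∈ pin n w | q = (m - 1, x) ∨ Prec q (m - 1, x)} := by
    refine card_le_card_of_injOn (fun y => (m - 1, y)) ?_ (Prod.mk_right_injective _).injOn
    intro y hy
    obtain ⟨hy, hxy⟩ := mem_filter.1 hy
    refine mem_filter.2 ⟨(hB y).1 hy, ?_⟩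
    rcases hxy.eq_or_lt with rfl | hxy
    · exact .inl rfl
    · exact .inr (.inr ⟨rfl, hxy⟩)
  have hcolor : ∀ v ∈ ({v ∈ (Icc 1 n).image w \ pin n w | Prec v (m - 1, x)} : Finset _),
      v.1 = m - 1 ∧ x < v.2 := by
    intro v hv
    simp only [mem_filter, mem_sdiff, mem_image] at hv
    obtain ⟨⟨⟨i, hi, rfl⟩, -⟩, hvx⟩ := hv
    have := (hw.1 i hi).1
    unfold Prec at hvx
    simp only at hvx
    omega
  have hright : #{v ∈ (Icc 1 n).image w \ pin n w | Prec v (m - 1, x)} ≤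
      #{y ∈ (Icc 1 n \ A) \ B | x < y} := by
    refine card_le_card_of_injOn Prod.snd ?_ ?_
    · intro v hv
      have hvc := hcolor v hv
      simp only [coe_filter, Set.mem_ofPred_eq, mem_sdiff, mem_image] at hv
      obtain ⟨⟨⟨i, hi, rfl⟩, hvP⟩, -⟩ := hv
      have hnorm : ∀ c, (c, (w i).2) ∉ pin n w := by
        intro c hc
        obtain ⟨k, hk, -, hkw⟩ := mem_pin.1 hc
        have hki : k = i :=
          hw.2 ⟨by omega, by omega⟩ (by simpa using hi) (show (w k).2 = (w i).2 by rw [hkw])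
        rw [← hkw, hki] at hc
        exact hvP hc
      refine mem_filter.2 ⟨mem_sdiff.2 ⟨mem_sdiff.2 ⟨(hw.1 i hi).2, fun hmem => ?_⟩,
        fun hmem => hnorm _ ((hB _).1 hmem)⟩, hvc.2⟩
      obtain ⟨c, -, hc⟩ := (hA _).1 hmem
      exact hnorm c hc
    · intro u hu v hv huv
      exact Prod.ext ((hcolor u hu).1.trans (hcolor v hv).1.symm) huv
  omega

lemma isAdmissible_of_isBallot {m n : ℕ} (hm : 1 ≤ m) {P : Finset (ℕ × ℕ)} {A B : Finset ℕ}
    (hP : P ⊆ range m ×ˢ Icc 1 n) (hinj : Set.InjOn Prod.snd (P : Set (ℕ × ℕ)))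
    (hcard : 2 * #P < n) (hA : ∀ x, x ∈ A ↔ ∃ c < m - 1, (c, x) ∈ P)
    (hB : ∀ x, x ∈ B ↔ (m - 1, x) ∈ P) (hballot : IsBallot (Icc 1 n \ A) B) :
    IsAdmissible m n P := by
  refine isAdmissible_of_card_lt hm hP hinj rfl hcard fun p hp => ?_
  have hPcolor : ∀ q ∈ P, q.1 < m := fun q hq => mem_range.1 (mem_product.1 (hP hq)).1
  have hpm := hPcolor p hp
  rcases (Nat.le_sub_one_of_lt hpm).lt_or_eq with hlt | heq
  · rw [filter_true_of_mem (s := image _ _), card_image_of_injective _ (Prod.mk_right_injective _)]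
    · have h1 := card_filter_le P (fun q => q = p ∨ Prec q p)
      have h2 := le_card_sdiff (P.image Prod.snd) (Icc 1 n)
      rw [card_image_of_injOn hinj, Nat.card_Icc] at h2
      omega
    · intro v hv
      obtain ⟨x, -, rfl⟩ := mem_image.1 hv
      exact .inl hlt
  · have hpB : (m - 1, p.2) ∈ P := heq ▸ hp
    have key := hballot p.2 ((hB _).2 hpB)
    have hcolor : ∀ q ∈ ({q ∈ P | q = p ∨ Prec q p} : Finset _), q.1 = m - 1 ∧ p.2 ≤ q.2 := by
      intro q hq
      obtain ⟨hq, rfl | hqp⟩ := mem_filter.1 hq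
      · exact ⟨heq, le_rfl⟩
      · have := hPcolor q hq
        unfold Prec at hqp
        omega
    have hleft : #{q ∈ P | q = p ∨ Prec q p} ≤ #{y ∈ B | p.2 ≤ y} := by
      refine card_le_card_of_injOn Prod.snd ?_ ?_
      · intro q hq
        have hqc := hcolor q hq
        exact mem_filter.2 ⟨(hB _).2 (hqc.1 ▸ (mem_filter.1 hq).1), hqc.2⟩
      · exact hinj.mono fun q hq => (mem_filter.1 hq).1
    refine hleft.trans_lt (key.trans_le ?_)
    refine card_le_card_of_injOn (fun y => (m - 1, y)) ?_ (Prod.mk_right_injective _).injOn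
    intro y hy
    obtain ⟨hy, hpy⟩ := mem_filter.1 hy
    obtain ⟨hy, hyB⟩ := mem_sdiff.1 hy
    obtain ⟨hy, hyA⟩ := mem_sdiff.1 hy
    refine mem_filter.2 ⟨mem_image_of_mem _ (mem_sdiff.2 ⟨hy, fun hmem => ?_⟩), .inr ⟨heq.symm, hpy⟩⟩
    obtain ⟨q, hq, rfl⟩ := mem_image.1 hmem
    rcases (Nat.le_sub_one_of_lt (hPcolor q hq)).lt_or_eq with h | h
    · exact hyA ((hA _).2 ⟨q.1, h, hq⟩)
    · exact hyB ((hB _).2 (h ▸ hq))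

/-- The set of symbols with norms in `A` colored by `f`, and norms in `B` of color `c`. -/
def coloredSet (c : ℕ) (A : Finset ℕ) (f : ∀ x ∈ A, ℕ) (B : Finset ℕ) : Finset (ℕ × ℕ) :=
  A.attach.image (fun x => (f x.1 x.2, x.1)) ∪ B.image (fun x => (c, x))

lemma mem_coloredSet {c : ℕ} {A : Finset ℕ} {f : ∀ x ∈ A, ℕ} {B : Finset ℕ} {p : ℕ × ℕ} :
    p ∈ coloredSet c A f B ↔ (∃ h : p.2 ∈ A, f p.2 h = p.1) ∨ (p.1 = c ∧ p.2 ∈ B) := by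
  obtain ⟨a, x⟩ := p
  simp only [coloredSet, mem_union, mem_image, mem_attach, true_and, Subtype.exists, Prod.mk.injEq]
  refine or_congr ⟨?_, ?_⟩ ⟨?_, ?_⟩
  · rintro ⟨y, hy, h, rfl⟩
    exact ⟨hy, h⟩
  · rintro ⟨hx, h⟩
    exact ⟨x, hx, h, rfl⟩
  · rintro ⟨y, hy, rfl, rfl⟩
    exact ⟨rfl, hy⟩
  · rintro ⟨rfl, hx⟩
    exact ⟨x, hx, rfl, rfl⟩

section coloredSet

variable {c : ℕ} {A B : Finset ℕ} {f : ∀ x ∈ A, ℕ}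

lemma mem_left_iff_coloredSet (hf : ∀ x h, f x h < c) (x : ℕ) :
    x ∈ A ↔ ∃ a < c, (a, x) ∈ coloredSet c A f B := by
  simp only [mem_coloredSet]
  constructor
  · exact fun h => ⟨f x h, hf x h, .inl ⟨h, rfl⟩⟩
  · rintro ⟨a, ha, ⟨h, -⟩ | ⟨h, -⟩⟩
    · exact h
    · omega

lemma mem_right_iff_coloredSet (hf : ∀ x h, f x h < c) (x : ℕ) :
    x ∈ B ↔ (c, x) ∈ coloredSet c A f B := by
  simp only [mem_coloredSet, true_and]
  constructor
  · exact .inr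
  · rintro (⟨h, h'⟩ | h)
    · exact absurd h' (hf x h).ne
    · exact h

lemma card_coloredSet_le : #(coloredSet c A f B) ≤ #A + #B := by
  refine (card_union_le _ _).trans (Nat.add_le_add ?_ card_image_le)
  exact card_image_le.trans card_attach.le

lemma injOn_snd_coloredSet (hAB : Disjoint A B) :
    Set.InjOn Prod.snd (coloredSet c A f B : Set (ℕ × ℕ)) := by
  rintro ⟨a, x⟩ hp ⟨b, y⟩ hq hxy
  obtain rfl : x = y := hxy
  rw [mem_coe, mem_coloredSet] at hp hq
  rw [disjoint_left] at hAB
  grind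

end coloredSet

open Classical in
/-- Triples `(A, f, B)` parametrizing the admissible pinnacle sets with at most `d` elements:
`A` with the coloring `f` collects the entries whose color is below `m - 1`, and `B` consists of
the norms of the entries of color `m - 1`. -/
noncomputable def pinnacleData (m n d : ℕ) :
    Finset (Σ A : Finset ℕ, (∀ x ∈ A, ℕ) × Finset ℕ) :=
  {A ∈ (Icc 1 n).powerset | #A ≤ d}.sigma fun A =>
    A.pi (fun _ => range (m - 1)) ×ˢ ballotSets (Icc 1 n \ A) (d - #A)

lemma mem_pinnacleData {m n d : ℕ} {t : Σ A : Finset ℕ, (∀ x ∈ A, ℕ) × Finset ℕ} :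
    t ∈ pinnacleData m n d ↔ (t.1 ⊆ Icc 1 n ∧ #t.1 ≤ d) ∧ (∀ x h, t.2.1 x h < m - 1) ∧
      t.2.2 ⊆ Icc 1 n \ t.1 ∧ #t.2.2 ≤ d - #t.1 ∧ IsBallot (Icc 1 n \ t.1) t.2.2 := by
  simp [pinnacleData, mem_ballotSets]

lemma card_pinnacleData {m n d : ℕ} (hd : 2 * d < n) :
    #(pinnacleData m n d) = ∑ k ∈ range (d + 1),
      (m - 1) ^ k * n.choose k * (n - k - 1).choose (d - k) := by
  classical
  have hterm : ∀ A ∈ ({A ∈ (Icc 1 n).powerset | #A ≤ d} : Finset (Finset ℕ)),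
      #(A.pi (fun _ => range (m - 1)) ×ˢ ballotSets (Icc 1 n \ A) (d - #A)) =
        (m - 1) ^ #A * (n - #A - 1).choose (d - #A) := by
    intro A hA
    obtain ⟨hA, hAd⟩ := mem_filter.1 hA
    have hcard : #(Icc 1 n \ A) = n - #A := by
      rw [card_sdiff_of_subset (mem_powerset.1 hA), Nat.card_Icc, Nat.add_sub_cancel]
    rw [card_product, card_pi, card_ballotSets (card_pos.1 (by omega)) (by omega), hcard]
    simp
  rw [pinnacleData, card_sigma, sum_congr rfl hterm,
    ← sum_fiberwise_of_maps_to (g := card) (t := range (d + 1))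
      (fun A hA => mem_range.2 (Nat.lt_succ_of_le (mem_filter.1 hA).2))]
  refine sum_congr rfl fun k hk => ?_
  have hfiber : ({A ∈ {A ∈ (Icc 1 n).powerset | #A ≤ d} | #A = k} : Finset (Finset ℕ)) =
      (Icc 1 n).powersetCard k := by
    ext A
    have := mem_range.1 hk
    simp only [mem_filter, mem_powerset, mem_powersetCard]
    constructor
    · exact fun h => ⟨h.1.1, h.2⟩
    · exact fun h => ⟨⟨h.1, by omega⟩, h.2⟩
  rw [hfiber, sum_congr rfl (g := fun _ => (m - 1) ^ k * (n - k - 1).choose (d - k))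
    fun A hA => by rw [(mem_powersetCard.1 hA).2]]
  rw [sum_const, card_powersetCard, Nat.card_Icc, Nat.add_sub_cancel, smul_eq_mul]
  ring

lemma injOn_coloredSet (m n d : ℕ) :
    Set.InjOn (fun t : Σ A : Finset ℕ, (∀ x ∈ A, ℕ) × Finset ℕ =>
      coloredSet (m - 1) t.1 t.2.1 t.2.2) (pinnacleData m n d) := by
  rintro ⟨A, f, B⟩ ht ⟨A', f', B'⟩ ht' heq
  have hf := (mem_pinnacleData.1 ht).2.1
  have hf' := (mem_pinnacleData.1 ht').2.1
  simp only at hf hf' heq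
  obtain rfl : A = A' := by
    ext x
    rw [mem_left_iff_coloredSet (B := B) hf, heq, ← mem_left_iff_coloredSet hf']
  obtain rfl : B = B' := by
    ext x
    rw [mem_right_iff_coloredSet hf, heq, ← mem_right_iff_coloredSet hf']
  obtain rfl : f = f' := by
    funext x hx
    have hmem : (f x hx, x) ∈ coloredSet (m - 1) A f B := mem_coloredSet.2 (.inl ⟨hx, rfl⟩)
    rw [heq, mem_coloredSet] at hmem
    rcases hmem with ⟨_, h⟩ | ⟨h, -⟩
    · exact h.symm
    · exact absurd h (hf x hx).ne
  rfl

lemma APS_eq_image {m n d : ℕ} (hm : 1 ≤ m) (hd : 2 * d < n) :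
    APS m n d = (fun t : Σ A : Finset ℕ, (∀ x ∈ A, ℕ) × Finset ℕ =>
      coloredSet (m - 1) t.1 t.2.1 t.2.2) '' (pinnacleData m n d) := by
  classical
  ext P
  constructor
  · rintro ⟨hadm, hPd⟩
    set A := {p ∈ P | p.1 < m - 1}.image Prod.snd with hAdef
    set B := {p ∈ P | p.1 = m - 1}.image Prod.snd with hBdef
    have hA : ∀ x, x ∈ A ↔ ∃ c < m - 1, (c, x) ∈ P := fun x => by
      simp [hAdef, and_comm]
    have hB : ∀ x, x ∈ B ↔ (m - 1, x) ∈ P := fun x => by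
      simp [hBdef]
    have hsub := hadm.subset
    have hinj := hadm.injOn_snd
    choose! f hfc hfP using fun x => (hA x).1
    have hcardA : #A = #{p ∈ P | p.1 < m - 1} :=
      card_image_of_injOn (hinj.mono fun q hq => (mem_filter.1 hq).1)
    have hcardB : #B = #{p ∈ P | p.1 = m - 1} :=
      card_image_of_injOn (hinj.mono fun q hq => (mem_filter.1 hq).1)
    have hcard : #A + #B ≤ #P := by
      rw [hcardA, hcardB, ← card_union_of_disjoint]
      · exact card_le_card (union_subset (filter_subset _ _) (filter_subset _ _))
      · exact disjoint_filter.2 fun p _ h h' => by omega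
    refine ⟨⟨A, fun x _ => f x, B⟩, mem_pinnacleData.2
      ⟨⟨fun x hx => (mem_product.1 (hsub (hfP x hx))).2, by dsimp only; omega⟩, hfc,
        fun x hx => mem_sdiff.2 ⟨(mem_product.1 (hsub ((hB x).1 hx))).2, fun hxA => ?_⟩,
        by dsimp only; omega, hadm.isBallot hA hB⟩, ?_⟩
    · have h := congrArg Prod.fst (hinj (hfP x hxA) ((hB x).1 hx) rfl)
      have := hfc x hxA
      simp only at h
      omega
    · ext ⟨a, x⟩
      simp only [mem_coloredSet]
      constructor
      · rintro (⟨hx, rfl⟩ | ⟨rfl, hx⟩)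
        · exact hfP x hx
        · exact (hB x).1 hx
      · intro hp
        have ha : a < m := mem_range.1 (mem_product.1 (hsub hp)).1
        rcases (Nat.le_sub_one_of_lt ha).lt_or_eq with h | h
        · have hx := (hA x).2 ⟨a, h, hp⟩
          exact .inl ⟨hx, congrArg Prod.fst (hinj (hfP x hx) hp rfl)⟩
        · exact .inr ⟨h, (hB x).2 (h ▸ hp)⟩
  · rintro ⟨⟨A, f, B⟩, ht, rfl⟩
    obtain ⟨⟨hA, hAd⟩, hf, hB, hBd, hballot⟩ := mem_pinnacleData.1 ht
    simp only at hA hAd hf hB hBd hballot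
    have hcard := card_coloredSet_le (c := m - 1) (A := A) (f := f) (B := B)
    refine ⟨isAdmissible_of_isBallot hm ?_
      (injOn_snd_coloredSet (disjoint_sdiff.mono_right hB)) (by dsimp only; omega)
      (mem_left_iff_coloredSet hf) (mem_right_iff_coloredSet hf) hballot, by dsimp only; omega⟩
    intro p hp
    rw [mem_product, mem_range]
    rcases mem_coloredSet.1 hp with ⟨hx, h⟩ | ⟨h, hx⟩
    · have hlt : p.1 < m - 1 := h ▸ hf _ hx
      exact ⟨by omega, hA hx⟩
    · exact ⟨by omega, (mem_sdiff.1 (hB hx)).1⟩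

/-- `#APS_d(m,n) = Σ_{k=0}^{d} (m-1)^k C(n,k) C(n-k-1, d-k)`. -/
theorem APS_card_positive (m n d : ℕ) (hm : 1 ≤ m) (hn : 1 ≤ n)
    (hd : d ≤ (n - 1) / 2) :
    (APS m n d).ncard =
      ∑ k ∈ Finset.range (d + 1),
        (m - 1) ^ k * Nat.choose n k * Nat.choose (n - k - 1) (d - k) := by
  have hd' : 2 * d < n := by omega
  rw [APS_eq_image hm hd', (injOn_coloredSet m n d).ncard_image,
    Set.ncard_coe_finset, card_pinnacleData hd']
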